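/- arXiv:2510.10944 — 3 statements merged into one kernel-verified Lean document; each statement's English description precedes it below -/
import Mathlib

section
/- (Theorem 1, exact form.) Fix real constants σ² > 0, τ > 0, β₀ > 0, α₀ > 0, H > 0, 0 ≤ D_min < D_max, a positive integer M, a positive integer N_m, a real R̄ ≥ 0, and λ > 0. Define γ̄ = 2^{R̄} − 1 and ν₀ = ((D_max² + H²)^{α₀/2+1} − (D_min² + H²)^{α₀/2+1}) / (β₀ (D_max² − D_min²)(α₀/2 + 1)). For each n ∈ ℕ, let the conditional total power given n users be defined as the integral over (d₁,…,d_n) ∈ [D_min, D_max]ⁿ, with respect to the product density ∏_{k=1}^n 2 d_k/(D_max² − D_min²), of ∑_{k=1}^n [σ² (2^{nR̄} − 1) (d_k² + H²)^{α₀/2}] / (τ N_m M n β₀) (this quantity is 0 when n = 0). Then the total average transmit power, namely the series ∑_{n=0}^{∞} e^{−λ} (λⁿ/n!) times the conditional total power given n users, equals (ν₀ σ² / (τ M N_m)) · (e^{γ̄ λ} − 1). -/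
open MeasureTheory

/-- Integrating a sum of one-coordinate functions against a product density. -/
lemma integral_pi_prod_mul_sum {n : ℕ} (μ : Measure ℝ) [SigmaFinite μ] (p g : ℝ → ℝ)
    (hp : Integrable p μ) (hpg : Integrable (fun x => p x * g x) μ) (hp1 : ∫ x, p x ∂μ = 1) :
    ∫ d : Fin n → ℝ, (∏ k, p (d k)) * ∑ k, g (d k) ∂(Measure.pi fun _ => μ) =
      n * ∫ x, p x * g x ∂μ := by
  have key (j : Fin n) : (fun d : Fin n → ℝ => (∏ k, p (d k)) * g (d j)) =
      fun d => ∏ k, (if k = j then fun x => p x * g x else p) (d k) := by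
    funext d
    rw [← Finset.mul_prod_erase _ _ (Finset.mem_univ j),
      ← Finset.mul_prod_erase _ (fun k => (if k = j then fun x => p x * g x else p) (d k))
        (Finset.mem_univ j)]
    have h : ∏ k ∈ Finset.univ.erase j, (if k = j then fun x => p x * g x else p) (d k) =
        ∏ k ∈ Finset.univ.erase j, p (d k) :=
      Finset.prod_congr rfl fun k hk => by rw [if_neg (Finset.ne_of_mem_erase hk)]
    rw [h, if_pos rfl]
    ring
  have hint (j : Fin n) : Integrable (fun d : Fin n → ℝ => (∏ k, p (d k)) * g (d j))
      (Measure.pi fun _ => μ) := by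
    rw [key]
    refine Integrable.fintype_prod (fun k => ?_)
    split_ifs
    · exact hpg
    · exact hp
  have hval (j : Fin n) : ∫ d : Fin n → ℝ, (∏ k, p (d k)) * g (d j) ∂(Measure.pi fun _ => μ) =
      ∫ x, p x * g x ∂μ := by
    rw [key, integral_fintype_prod_eq_prod, ← Finset.mul_prod_erase _ _ (Finset.mem_univ j),
      Finset.prod_eq_one (fun k hk => by simp [Finset.ne_of_mem_erase hk, hp1])]
    simp
  simp_rw [Finset.mul_sum]
  rw [integral_finsetSum _ fun j _ => hint j]
  simp [hval]

lemma integral_mul_rpow_sq_add_sq {H a b s : ℝ} (hH : 0 < H) (hs : 0 < s) :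
    ∫ x in a..b, 2 * x * (x ^ 2 + H ^ 2) ^ s =
      ((b ^ 2 + H ^ 2) ^ (s + 1) - (a ^ 2 + H ^ 2) ^ (s + 1)) / (s + 1) := by
  have hpos (x : ℝ) : x ^ 2 + H ^ 2 ≠ 0 := by positivity
  rw [intervalIntegral.integral_eq_sub_of_hasDerivAt
    (f := fun x => (x ^ 2 + H ^ 2) ^ (s + 1) / (s + 1))]
  · ring
  · intro x _
    have h := ((((hasDerivAt_id x).pow 2).add_const (H ^ 2)).rpow_const
      (p := s + 1) (Or.inl (hpos x))).div_const (s + 1)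
    refine h.congr_deriv ?_
    have : s + 1 ≠ 0 := by positivity
    simp
    field_simp
  · refine Continuous.intervalIntegrable ?_ _ _
    exact (by fun_prop : Continuous fun x : ℝ => 2 * x).mul
      ((by fun_prop : Continuous fun x : ℝ => x ^ 2 + H ^ 2).rpow_const
        fun x => Or.inl (hpos x))

/-- The Poisson series underlying the average of `b ^ n - 1`. -/
lemma hasSum_poisson_pow_sub_one (b r : ℝ) :
    HasSum (fun n : ℕ => Real.exp (-r) * (r ^ n / n.factorial) * (b ^ n - 1))
      (Real.exp ((b - 1) * r) - 1) := by
  have h (x : ℝ) : HasSum (fun n : ℕ => x ^ n / n.factorial) (Real.exp x) := by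
    rw [Real.exp_eq_exp_ℝ]
    exact NormedSpace.expSeries_div_hasSum_exp x
  convert! ((h (b * r)).sub (h r)).mul_left (Real.exp (-r)) using 1
  · funext n
    rw [mul_pow]
    ring
  · rw [mul_sub, ← Real.exp_add, ← Real.exp_add]
    simp only [neg_add_cancel, Real.exp_zero]
    ring_nf

/-- Theorem 1 of the paper (exact form): the total average transmit power of a sector
with `Nm` antennas serving a Poisson(λ) number of users, each user's horizontal distance
being i.i.d. with density `2d/(D_max² − D_min²)` on `[D_min, D_max]`, equals
`(ν₀ σ² / (τ M Nm)) (e^{γ̄ λ} − 1)` where `γ̄ = 2^R̄ − 1`. -/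
theorem stmt_2 (σ2 τ β₀ α₀ H Dmin Dmax : ℝ) (M Nm : ℕ) (R lam : ℝ)
    (hσ : 0 < σ2) (hτ : 0 < τ) (hβ : 0 < β₀) (hα : 0 < α₀) (hH : 0 < H)
    (hDmin : 0 ≤ Dmin) (hD : Dmin < Dmax) (hM : 0 < M) (hNm : 0 < Nm)
    (hR : 0 ≤ R) (hlam : 0 < lam) :
    ∑' n : ℕ, Real.exp (-lam) * (lam ^ n / (Nat.factorial n)) *
        (∫ d : Fin n → ℝ in Set.univ.pi (fun _ => Set.Icc Dmin Dmax),
          (∏ k, 2 * d k / (Dmax ^ 2 - Dmin ^ 2)) *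
            ∑ k, σ2 * ((2 : ℝ) ^ ((n : ℝ) * R) - 1) * ((d k) ^ 2 + H ^ 2) ^ (α₀ / 2) /
              (τ * Nm * M * n * β₀)) =
      ((((Dmax ^ 2 + H ^ 2) ^ (α₀ / 2 + 1) - (Dmin ^ 2 + H ^ 2) ^ (α₀ / 2 + 1)) /
          (β₀ * (Dmax ^ 2 - Dmin ^ 2) * (α₀ / 2 + 1))) * σ2 / (τ * M * Nm)) *
        (Real.exp (((2 : ℝ) ^ R - 1) * lam) - 1) := by
  have hDD : 0 < Dmax ^ 2 - Dmin ^ 2 := by nlinarith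
  have hpos (x : ℝ) : x ^ 2 + H ^ 2 ≠ 0 := by positivity
  set μ : Measure ℝ := volume.restrict (Set.Icc Dmin Dmax) with hμ
  set p : ℝ → ℝ := fun x => 2 * x / (Dmax ^ 2 - Dmin ^ 2) with hp
  have hpc : Continuous p := by fun_prop
  have hgc : Continuous fun x : ℝ => (x ^ 2 + H ^ 2) ^ (α₀ / 2) :=
    (by fun_prop : Continuous fun x : ℝ => x ^ 2 + H ^ 2).rpow_const fun x => Or.inl (hpos x)
  have hpi : Integrable p μ := hpc.integrableOn_Icc
  have hp1 : ∫ x, p x ∂μ = 1 := by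
    rw [hμ, integral_Icc_eq_integral_Ioc, ← intervalIntegral.integral_of_le hD.le]
    simp only [hp]
    rw [intervalIntegral.integral_div, intervalIntegral.integral_const_mul, integral_id]
    field_simp
  have hpg : ∫ x, p x * (x ^ 2 + H ^ 2) ^ (α₀ / 2) ∂μ =
      ((Dmax ^ 2 + H ^ 2) ^ (α₀ / 2 + 1) - (Dmin ^ 2 + H ^ 2) ^ (α₀ / 2 + 1)) /
        (α₀ / 2 + 1) / (Dmax ^ 2 - Dmin ^ 2) := by
    rw [hμ, integral_Icc_eq_integral_Ioc, ← intervalIntegral.integral_of_le hD.le,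
      ← integral_mul_rpow_sq_add_sq hH (half_pos hα), ← intervalIntegral.integral_div]
    simp only [hp, div_mul_eq_mul_div]
  have hcond (n : ℕ) : (∫ d : Fin n → ℝ in Set.univ.pi (fun _ => Set.Icc Dmin Dmax),
        (∏ k, 2 * d k / (Dmax ^ 2 - Dmin ^ 2)) *
          ∑ k, σ2 * ((2 : ℝ) ^ ((n : ℝ) * R) - 1) * ((d k) ^ 2 + H ^ 2) ^ (α₀ / 2) /
            (τ * Nm * M * n * β₀)) =
      n * (σ2 * ((2 : ℝ) ^ ((n : ℝ) * R) - 1) / (τ * Nm * M * n * β₀) *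
        ∫ x, p x * (x ^ 2 + H ^ 2) ^ (α₀ / 2) ∂μ) := by
    have hg : Continuous fun x : ℝ =>
        σ2 * ((2 : ℝ) ^ ((n : ℝ) * R) - 1) * (x ^ 2 + H ^ 2) ^ (α₀ / 2) /
          (τ * Nm * M * n * β₀) := (continuous_const.mul hgc).div_const _
    rw [volume_pi, Measure.restrict_pi_pi]
    refine (integral_pi_prod_mul_sum μ p _ hpi (hpc.mul hg).integrableOn_Icc hp1).trans ?_
    congr 1
    rw [← integral_const_mul]
    congr 1
    funext x
    ring
  have hpow (n : ℕ) : (2 : ℝ) ^ ((n : ℝ) * R) = ((2 : ℝ) ^ R) ^ n := by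
    rw [mul_comm, Real.rpow_mul_natCast (by norm_num)]
  refine ((hasSum_poisson_pow_sub_one ((2 : ℝ) ^ R) lam).mul_left _).tsum_eq ▸ ?_
  congr 1
  funext n
  rw [hcond, hpg, hpow]
  rcases Nat.eq_zero_or_pos n with rfl | hn
  · simp
  · have hnR : (n : ℝ) ≠ 0 := by positivity
    have hMR : (M : ℝ) ≠ 0 := by positivity
    have hNR : (Nm : ℝ) ≠ 0 := by positivity
    have hs : α₀ / 2 + 1 ≠ 0 := by positivity
    field_simp
end

section
/- Let M be a positive integer, and let ν₀, σ², τ, N, γ̄, λ_sum be positive real numbers. Let λ : Fin M → ℝ with λ_m ≥ 0 for all m and ∑_m λ_m = λ_sum, and let n : Fin M → ℝ with n_m > 0 for all m and ∑_m n_m ≤ N. Then ∑_m (ν₀ σ² / (τ M n_m)) · e^{γ̄ λ_m} ≥ (M ν₀ σ² / (τ N)) · e^{γ̄ λ_sum / M}. -/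
/-- Jensen's inequality for the exponential with uniform weights, in unnormalized form. -/
theorem card_mul_exp_sum_div_card_le {ι : Type*} [Fintype ι] [Nonempty ι] (x : ι → ℝ) :
    (Fintype.card ι : ℝ) * Real.exp ((∑ i, x i) / Fintype.card ι) ≤ ∑ i, Real.exp (x i) := by
  have hc : (0 : ℝ) < Fintype.card ι := by exact_mod_cast Fintype.card_pos
  have h := convexOn_exp.map_sum_le (t := Finset.univ) (p := x)
    (w := fun _ : ι => (Fintype.card ι : ℝ)⁻¹) (fun _ _ => by positivity)
    (by simp [hc.ne']) (fun _ _ => Set.mem_univ _)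
  simp only [smul_eq_mul, ← Finset.mul_sum] at h
  rwa [inv_mul_eq_div, inv_mul_eq_div, le_div_iff₀' hc] at h

/-- Minimizing `∑ exp (x i) / n i` for a fixed sum of `x` and a bounded sum of `n`: the uniform
choice is optimal. -/
theorem card_sq_mul_exp_div_le_sum_exp_div {ι : Type*} [Fintype ι] [Nonempty ι]
    (x n : ι → ℝ) {N : ℝ} (hn : ∀ i, 0 < n i) (hN : ∑ i, n i ≤ N) :
    (Fintype.card ι : ℝ) ^ 2 * Real.exp ((∑ i, x i) / Fintype.card ι) / N ≤
      ∑ i, Real.exp (x i) / n i := by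
  have hpos : 0 < ∑ i, n i := Finset.sum_pos (fun i _ => hn i) Finset.univ_nonempty
  have hsq : ∀ y : ℝ, Real.exp (y / 2) ^ 2 = Real.exp y := fun y => by
    rw [← Real.exp_nat_mul]; congr 1; push_cast; ring
  have hJ := card_mul_exp_sum_div_card_le fun i => x i / 2
  rw [← Finset.sum_div, div_right_comm] at hJ
  calc (Fintype.card ι : ℝ) ^ 2 * Real.exp ((∑ i, x i) / Fintype.card ι) / N
      = (Fintype.card ι * Real.exp ((∑ i, x i) / Fintype.card ι / 2)) ^ 2 / N := by
        rw [mul_pow, hsq]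
    _ ≤ (∑ i, Real.exp (x i / 2)) ^ 2 / ∑ i, n i := by gcongr
    _ ≤ ∑ i, Real.exp (x i / 2) ^ 2 / n i :=
        Finset.sq_sum_div_le_sum_sq_div _ _ fun i _ => hn i
    _ = ∑ i, Real.exp (x i) / n i := by simp only [hsq]


/-- Power lower bound (29): for any nonnegative user distribution `λ` summing to
`λ_sum` and any positive continuous antenna allocation `n` with `∑ n_m ≤ N`, the total
average transmit power is at least `(M ν₀ σ²/(τ N)) e^{γ̄ λ_sum / M}`. -/
theorem stmt_7 (M : ℕ) (hM : 0 < M) (ν₀ σ2 τ N γ lamsum : ℝ)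
    (hν : 0 < ν₀) (hσ : 0 < σ2) (hτ : 0 < τ) (hN : 0 < N) (hγ : 0 < γ)
    (hlamsum : 0 < lamsum)
    (lam : Fin M → ℝ) (hlam : ∀ m, 0 ≤ lam m) (hlamsum' : ∑ m, lam m = lamsum)
    (n : Fin M → ℝ) (hn : ∀ m, 0 < n m) (hnsum : ∑ m, n m ≤ N) :
    (M : ℝ) * ν₀ * σ2 / (τ * N) * Real.exp (γ * lamsum / M) ≤
      ∑ m, (ν₀ * σ2 / (τ * M * n m)) * Real.exp (γ * lam m) := by
  have : Nonempty (Fin M) := ⟨⟨0, hM⟩⟩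
  have hM' : (0 : ℝ) < M := by exact_mod_cast hM
  have h := card_sq_mul_exp_div_le_sum_exp_div (fun m => γ * lam m) n hn hnsum
  rw [← Finset.mul_sum, hlamsum', Fintype.card_fin] at h
  calc (M : ℝ) * ν₀ * σ2 / (τ * N) * Real.exp (γ * lamsum / M)
      = ν₀ * σ2 / (τ * M) * ((M : ℝ) ^ 2 * Real.exp (γ * lamsum / M) / N) := by
        field_simp
    _ ≤ ν₀ * σ2 / (τ * M) * ∑ m, Real.exp (γ * lam m) / n m := by gcongr
    _ = ∑ m, (ν₀ * σ2 / (τ * M * n m)) * Real.exp (γ * lam m) := by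
        rw [Finset.mul_sum]
        refine Finset.sum_congr rfl fun m _ => ?_
        rw [div_mul_div_comm, div_mul_eq_mul_div]
end

section
/- Let M be a positive integer, γ̄ > 0 and λ_sum > 0 real numbers, and γ : Fin M → ℝ with γ_m > 0 for all m. Suppose μ > 0 is such that λ*_m := max{0, (1/γ̄)·ln(μ γ_m / γ̄)} satisfies ∑_m λ*_m = λ_sum. Then for every λ : Fin M → ℝ with λ_m ≥ 0 for all m and ∑_m λ_m = λ_sum, we have ∑_m (1/γ_m)·e^{γ̄ λ_m} ≥ ∑_m (1/γ_m)·e^{γ̄ λ*_m}. -/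
/-- The exponential cost `e^{a x} / g` on `x ≥ 0` lies above its supporting line of slope `μ`
at the water-filling point. -/
theorem exp_cost_ge_supporting_line {a g μ x : ℝ} (ha : 0 < a) (hg : 0 < g) (hμ : 0 < μ)
    (hx : 0 ≤ x) :
    let y := max 0 ((1 / a) * Real.log (μ * g / a))
    (1 / g) * Real.exp (a * y) + μ * (x - y) ≤ (1 / g) * Real.exp (a * x) := by
  intro y
  have tangent : Real.exp (a * y) * (1 + a * (x - y)) ≤ Real.exp (a * x) := by
    calc Real.exp (a * y) * (1 + a * (x - y))
        ≤ Real.exp (a * y) * Real.exp (a * (x - y)) := by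
          gcongr
          linarith [Real.add_one_le_exp (a * (x - y))]
      _ = Real.exp (a * x) := by rw [← Real.exp_add]; ring_nf
  have slope : μ * (x - y) ≤ (1 / g) * (Real.exp (a * y) * (a * (x - y))) := by
    have hpos : 0 < μ * g / a := by positivity
    rcases le_total ((1 / a) * Real.log (μ * g / a)) 0 with h | h
    · have hy : y = 0 := max_eq_left h
      have hlog : Real.log (μ * g / a) ≤ 0 := nonpos_of_mul_nonpos_right h (by positivity)
      have hle : μ * g ≤ a := by
        rwa [Real.log_nonpos_iff hpos.le, div_le_one ha] at hlog
      have hdiv : μ ≤ a / g := (le_div_iff₀ hg).2 hle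
      rw [hy]
      calc μ * (x - 0) ≤ a / g * (x - 0) := by gcongr
        _ = (1 / g) * (Real.exp (a * 0) * (a * (x - 0))) := by simp; ring
    · have hy : a * y = Real.log (μ * g / a) := by
        rw [show y = _ from max_eq_right h]
        field_simp
      rw [hy, Real.exp_log hpos]
      apply le_of_eq
      field_simp
  have scaled := mul_le_mul_of_nonneg_left tangent (one_div_pos.2 hg).le
  linarith

/-- General water-filling solution (34): if
`λ*_m = max{0, (1/γ̄) ln(μ γ_m / γ̄)}` sums to `λ_sum`, then it minimizes
`∑ e^{γ̄ λ_m}/γ_m` over nonnegative user distributions summing to `λ_sum`. -/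
theorem stmt_11 (M : ℕ) (hM : 0 < M) (γbar lamsum : ℝ) (hγbar : 0 < γbar)
    (hlamsum : 0 < lamsum) (γ : Fin M → ℝ) (hγ : ∀ m, 0 < γ m)
    (μ : ℝ) (hμ : 0 < μ)
    (lamstar : Fin M → ℝ)
    (hlamstar : ∀ m, lamstar m = max 0 ((1 / γbar) * Real.log (μ * γ m / γbar)))
    (hsumstar : ∑ m, lamstar m = lamsum)
    (lam : Fin M → ℝ) (hlam : ∀ m, 0 ≤ lam m) (hsum : ∑ m, lam m = lamsum) :
    ∑ m, (1 / γ m) * Real.exp (γbar * lamstar m) ≤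
      ∑ m, (1 / γ m) * Real.exp (γbar * lam m) := by
  have h := Finset.sum_le_sum fun m (_ : m ∈ Finset.univ) =>
    exp_cost_ge_supporting_line hγbar (hγ m) hμ (hlam m)
  simp only [← hlamstar, Finset.sum_add_distrib, ← Finset.mul_sum, Finset.sum_sub_distrib,
    hsum, hsumstar, sub_self, mul_zero, add_zero] at h
  exact h
end
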